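/- arXiv:2502.14698 — 4 statements merged into one kernel-verified Lean document; each statement's English description precedes it below -/
import Mathlib

section
/- Let L, L′ : ℝ^d → ℝ be functions such that L is twice continuously differentiable with Hessian locally Lipschitz near θ̄ (e.g. L is C³), and L′ is continuously differentiable with ∇L′ locally Lipschitz near θ̄. Suppose θ̄ satisfies ∇L(θ̄) = 0 and that H := Hess L(θ̄) is invertible. Let ε₀ > 0 and let θ* : (0, ε₀) → ℝ^d be a family of points satisfying ∇L(θ*(ε)) + ε·∇L′(θ*(ε)) = 0 for all ε ∈ (0, ε₀), and θ*(ε) → θ̄ as ε → 0⁺. Then there exist constants K ≥ 0 and ε₁ > 0 such that for all 0 < ε < ε₁, ‖θ*(ε) − θ̄ + ε·H⁻¹ ∇L′(θ̄)‖ ≤ K·ε². -/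
open Filter
open scoped Topology NNReal

open Asymptotics in
/-- First-order Taylor expansion with quadratic remainder, when the derivative is Lipschitz near
the base point. -/
theorem isBigO_sub_sub_fderiv_of_lipschitzOnWith {E F : Type*}
    [NormedAddCommGroup E] [NormedSpace ℝ E] [NormedAddCommGroup F] [NormedSpace ℝ F]
    {f : E → F} {x₀ : E} {K : ℝ≥0} {s : Set E} (hf : Differentiable ℝ f) (hs : s ∈ 𝓝 x₀)
    (hK : LipschitzOnWith K (fderiv ℝ f) s) :
    (fun x => f x - f x₀ - fderiv ℝ f x₀ (x - x₀)) =O[𝓝 x₀] fun x => ‖x - x₀‖ ^ 2 := by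
  obtain ⟨r, hr, hrs⟩ := Metric.mem_nhds_iff.1 hs
  refine IsBigO.of_bound K ?_
  filter_upwards [Metric.ball_mem_nhds x₀ hr] with x hx
  have hsub : Metric.closedBall x₀ ‖x - x₀‖ ⊆ s := fun y hy => hrs <| by
    rw [Metric.mem_closedBall] at hy
    rw [Metric.mem_ball, dist_eq_norm] at hx
    exact Metric.mem_ball.2 (hy.trans_lt hx)
  have hmean := (convex_closedBall x₀ ‖x - x₀‖).norm_image_sub_le_of_norm_fderiv_le'
    (𝕜 := ℝ) (f := f) (φ := fderiv ℝ f x₀) (C := K * ‖x - x₀‖) (x := x₀) (y := x)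
    (fun y _ => hf y) (fun y hy => ?_) (by simp) (by simp [dist_eq_norm])
  · rw [norm_pow, norm_norm]
    calc _ ≤ _ := hmean
      _ = _ := by ring
  · refine (hK.norm_sub_le (hsub hy) (mem_of_mem_nhds hs)).trans ?_
    rw [Metric.mem_closedBall, dist_eq_norm] at hy
    gcongr

open Asymptotics in
/-- Asymptotic expansion of a family of zeros of the perturbed map `f + ε • g` converging to a
nondegenerate zero of `f`. -/
theorem isBigO_zero_of_add_smul {E F : Type*}
    [NormedAddCommGroup E] [NormedSpace ℝ E] [NormedAddCommGroup F] [NormedSpace ℝ F]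
    {f g : E → F} {x₀ : E} {K K' : ℝ≥0} {s s' : Set E} {l : Filter ℝ} {x : ℝ → E}
    (hf : Differentiable ℝ f) (hs : s ∈ 𝓝 x₀) (hK : LipschitzOnWith K (fderiv ℝ f) s)
    (hs' : s' ∈ 𝓝 x₀) (hK' : LipschitzOnWith K' g s') (hf₀ : f x₀ = 0)
    (H : E ≃L[ℝ] F) (hH : (H : E →L[ℝ] F) = fderiv ℝ f x₀)
    (hx : ∀ᶠ ε in l, f (x ε) + ε • g (x ε) = 0) (hconv : Tendsto x l (𝓝 x₀)) :
    (fun ε => x ε - x₀ + ε • H.symm (g x₀)) =O[l] fun ε => ε ^ 2 := by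
  have hfx : (fun ε => f (x ε)) =O[l] fun ε => ε := by
    have hg : (fun ε => g (x ε)) =O[l] fun _ => (1 : ℝ) :=
      (((hK'.continuousOn.continuousAt hs').tendsto).comp hconv).isBigO_one ℝ
    have := ((isBigO_refl (fun ε : ℝ => ε) l).smul hg).neg_left
    simp only [smul_eq_mul, mul_one] at this
    exact this.congr' (hx.mono fun ε h => (eq_neg_of_add_eq_zero_left h).symm) .rfl
  have hd : HasFDerivAt f (H : E →L[ℝ] F) x₀ := hH ▸ (hf x₀).hasFDerivAt
  have hu : (fun ε => x ε - x₀) =O[l] fun ε => ε := by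
    have := (hd.isTheta_sub H.toHomeomorph.isInducing).isBigO_symm.comp_tendsto hconv
    simp only [hf₀, sub_zero] at this
    exact this.trans hfx
  have hrem : (fun ε => f (x ε) - H (x ε - x₀)) =O[l] fun ε => ε ^ 2 := by
    have := (isBigO_sub_sub_fderiv_of_lipschitzOnWith hf hs hK).comp_tendsto hconv
    simp only [hf₀, sub_zero, ← hH] at this
    exact this.trans (hu.norm_left.pow 2)
  have hgrem : (fun ε => ε • (g (x ε) - g x₀)) =O[l] fun ε => ε ^ 2 := by
    have : (fun ε => g (x ε) - g x₀) =O[l] fun ε => x ε - x₀ :=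
      IsBigO.of_bound K' <| (hconv.eventually_mem hs').mono fun ε h =>
        hK'.norm_sub_le h (mem_of_mem_nhds hs')
    simpa only [smul_eq_mul, ← sq] using (isBigO_refl (fun ε : ℝ => ε) l).smul (this.trans hu)
  refine ((H.symm : F →L[ℝ] E).isBigO_comp _ l).trans (hrem.neg_left.sub hgrem) |>.congr' ?_ .rfl
  filter_upwards [hx] with ε h
  have : -(f (x ε) - H (x ε - x₀)) - ε • (g (x ε) - g x₀) = H (x ε - x₀) + ε • g x₀ := by
    rw [eq_neg_of_add_eq_zero_left h]
    module
  refine (congrArg H.symm this).trans ?_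
  simp

/-- **Influence-function lemma.** Let `L` be `C²` with locally Lipschitz Hessian near `θ̄`,
`L′` be `C¹` with locally Lipschitz gradient near `θ̄`, `∇L(θ̄) = 0`, and let the Hessian
`H = D(∇L)(θ̄)` be invertible (realized as a continuous linear equivalence `H`). If
`θ*(ε)` satisfies `∇L(θ*(ε)) + ε·∇L′(θ*(ε)) = 0` on `(0, ε₀)` and `θ*(ε) → θ̄` as `ε → 0⁺`,
then `θ*(ε) = θ̄ − ε·H⁻¹∇L′(θ̄) + O(ε²)`. -/
theorem influence_function_lemma
    {d : ℕ} (L L' : EuclideanSpace ℝ (Fin d) → ℝ) (θb : EuclideanSpace ℝ (Fin d))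
    (hL : ContDiff ℝ 2 L)
    (hLHessLip : ∃ K : ℝ≥0, ∃ s ∈ 𝓝 θb,
      LipschitzOnWith K (fun θ => fderiv ℝ (gradient L) θ) s)
    (hL' : ContDiff ℝ 1 L')
    (hL'GradLip : ∃ K : ℝ≥0, ∃ s ∈ 𝓝 θb, LipschitzOnWith K (gradient L') s)
    (hcrit : gradient L θb = 0)
    (H : EuclideanSpace ℝ (Fin d) ≃L[ℝ] EuclideanSpace ℝ (Fin d))
    (hH : (H : EuclideanSpace ℝ (Fin d) →L[ℝ] EuclideanSpace ℝ (Fin d)) =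
      fderiv ℝ (gradient L) θb)
    (ε₀ : ℝ) (hε₀ : 0 < ε₀) (θs : ℝ → EuclideanSpace ℝ (Fin d))
    (hθs : ∀ ε ∈ Set.Ioo 0 ε₀, gradient L (θs ε) + ε • gradient L' (θs ε) = 0)
    (hconv : Tendsto θs (𝓝[>] 0) (𝓝 θb)) :
    ∃ K ≥ (0 : ℝ), ∃ ε₁ > (0 : ℝ), ε₁ ≤ ε₀ ∧ ∀ ε : ℝ, 0 < ε → ε < ε₁ →
      ‖θs ε - θb + ε • H.symm (gradient L' θb)‖ ≤ K * ε ^ 2 := by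
  obtain ⟨K, s, hs, hK⟩ := hLHessLip
  obtain ⟨K', s', hs', hK'⟩ := hL'GradLip
  have hdiff : Differentiable ℝ (gradient L) :=
    (InnerProductSpace.toDual ℝ (EuclideanSpace ℝ (Fin d))).symm.toContinuousLinearEquiv
      |>.differentiable.comp
        ((hL.fderiv_right (m := 1) (by norm_num)).differentiable one_ne_zero)
  obtain ⟨C, hC, hbound⟩ := (isBigO_zero_of_add_smul hdiff hs hK hs' hK' hcrit H hH
    (mem_of_superset (Ioo_mem_nhdsGT hε₀) hθs) hconv).exists_nonneg
  obtain ⟨δ, hδ, hsub⟩ := mem_nhdsGT_iff_exists_Ioo_subset.1 hbound.bound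
  refine ⟨C, hC, min δ ε₀, lt_min hδ hε₀, min_le_right _ _, fun ε hε hlt => ?_⟩
  simpa using hsub ⟨hε, hlt.trans_le (min_le_left _ _)⟩
end

section
/- Let d ≥ 1, a ∈ ℝ^d, ε₀ > 0, and let x : (0, ε₀) → ℝ^d satisfy x(ε) → 0 as ε → 0⁺. Suppose there exist constants C₁, C₂ ≥ 0 such that ‖x(ε) − ε·a‖ ≤ C₁·‖x(ε)‖² + C₂·ε² for all ε ∈ (0, ε₀). Then there exist constants K ≥ 0 and ε₁ > 0 such that ‖x(ε) − ε·a‖ ≤ K·ε² for all 0 < ε < ε₁. -/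
open Filter
open scoped Topology

/-- If `‖x - ε • a‖ ≤ C₁ * ‖x‖ ^ 2 + C₂ * ε ^ 2` with `ε` in the unit interval and `x` so small that
`C₁ * ‖x‖ ≤ 1 / 2`, then the quadratic term can be absorbed, so `‖x‖` is at most linear in `ε`. -/
theorem norm_le_of_norm_sub_smul_le {E : Type*} [SeminormedAddCommGroup E] [NormedSpace ℝ E]
    {a x : E} {ε C₁ C₂ : ℝ} (hε : 0 ≤ ε) (hε1 : ε ≤ 1) (hC₂ : 0 ≤ C₂)
    (hx : C₁ * ‖x‖ ≤ 1 / 2) (h : ‖x - ε • a‖ ≤ C₁ * ‖x‖ ^ 2 + C₂ * ε ^ 2) :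
    ‖x‖ ≤ 2 * (‖a‖ + C₂) * ε := by
  have htri : ‖x‖ ≤ ‖x - ε • a‖ + ε * ‖a‖ := by
    simpa [norm_smul, abs_of_nonneg hε] using norm_add_le (x - ε • a) (ε • a)
  have hquad : C₁ * ‖x‖ ^ 2 ≤ 1 / 2 * ‖x‖ := by
    rw [sq, ← mul_assoc]
    gcongr
  have hsq : C₂ * ε ^ 2 ≤ C₂ * ε := by
    gcongr
    nlinarith
  linarith

/-- **Joint convergence lemma.** If `x(ε) → 0` as `ε → 0⁺` and
`‖x(ε) − ε·a‖ ≤ C₁·‖x(ε)‖² + C₂·ε²` on `(0, ε₀)`, then `x(ε) = ε·a + O(ε²)`: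
there are `K ≥ 0` and `ε₁ > 0` with `‖x(ε) − ε·a‖ ≤ K·ε²` for all `0 < ε < ε₁`. -/
theorem joint_convergence_lemma
    {d : ℕ} (hd : 1 ≤ d) (a : EuclideanSpace ℝ (Fin d))
    (ε₀ : ℝ) (hε₀ : 0 < ε₀) (x : ℝ → EuclideanSpace ℝ (Fin d))
    (hx : Tendsto x (𝓝[>] 0) (𝓝 0))
    (C₁ C₂ : ℝ) (hC₁ : 0 ≤ C₁) (hC₂ : 0 ≤ C₂)
    (hb : ∀ ε ∈ Set.Ioo 0 ε₀, ‖x ε - ε • a‖ ≤ C₁ * ‖x ε‖ ^ 2 + C₂ * ε ^ 2) :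
    ∃ K ≥ (0 : ℝ), ∃ ε₁ > (0 : ℝ), ∀ ε : ℝ, 0 < ε → ε < ε₁ →
      ‖x ε - ε • a‖ ≤ K * ε ^ 2 := by
  have hlim : Tendsto (fun ε => C₁ * ‖x ε‖) (𝓝[>] 0) (𝓝 0) := by
    simpa using hx.norm.const_mul C₁
  have hsmall : ∀ᶠ ε in 𝓝[>] (0 : ℝ), C₁ * ‖x ε‖ ≤ 1 / 2 :=
    hlim.eventually_le_const (by norm_num)
  obtain ⟨δ, hδ, hδx⟩ := mem_nhdsGT_iff_exists_Ioo_subset.1 hsmall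
  refine ⟨C₁ * (2 * (‖a‖ + C₂)) ^ 2 + C₂, by positivity, min δ (min ε₀ 1),
    lt_min hδ (lt_min hε₀ one_pos), fun ε hε hlt => ?_⟩
  obtain ⟨hεδ, hεε₀, hε1⟩ : ε < δ ∧ ε < ε₀ ∧ ε < 1 := by simpa using hlt
  have hbε := hb ε ⟨hε, hεε₀⟩
  have hlin := norm_le_of_norm_sub_smul_le hε.le hε1.le hC₂ (hδx ⟨hε, hεδ⟩) hbε
  calc ‖x ε - ε • a‖ ≤ C₁ * ‖x ε‖ ^ 2 + C₂ * ε ^ 2 := hbε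
    _ ≤ C₁ * (2 * (‖a‖ + C₂) * ε) ^ 2 + C₂ * ε ^ 2 := by gcongr
    _ = (C₁ * (2 * (‖a‖ + C₂)) ^ 2 + C₂) * ε ^ 2 := by ring
end

section
/- Let ℓ₁, …, ℓ_N : ℝ^d → ℝ be twice continuously differentiable with Hessians locally Lipschitz near θ̄ (e.g. each ℓⱼ is C³), and let u : ℝ^d → ℝ be continuously differentiable with ∇u locally Lipschitz near θ̄. Suppose θ̄ satisfies Σⱼ ∇ℓⱼ(θ̄) = 0 and that H := Σⱼ Hess ℓⱼ(θ̄) is invertible. Set gᵢ := ∇ℓᵢ(θ̄) and F̂ := (1/N)·Σᵢ gᵢ gᵢ⊤. For each i ∈ {1,…,N} let ε₀ > 0 and θᵢ : (0, ε₀) → ℝ^d satisfy Σⱼ ∇ℓⱼ(θᵢ(ε)) − ε·∇ℓᵢ(θᵢ(ε)) = 0 for all ε ∈ (0, ε₀), with θᵢ(ε) → θ̄ as ε → 0⁺. Then lim_{ε→0⁺} ((N − ε)/ε²) · Var_{i∼U(1,…,N)}[u(θᵢ(ε))] = N · ⟨∇u(θ̄), H⁻¹ F̂ H⁻¹ ∇u(θ̄)⟩,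 where Var_{i∼U(1,…,N)} denotes the variance over i drawn uniformly from {1,…,N}. -/
open Filter
open scoped RealInnerProductSpace Topology NNReal BigOperators

section GradientHessian

variable {E : Type*} [NormedAddCommGroup E] [InnerProductSpace ℝ E] [CompleteSpace E]

/-- The gradient of a `C^(n+1)` function is `C^n`. -/
theorem ContDiff.contDiff_gradient {f : E → ℝ} {m n : WithTop ℕ∞} (hf : ContDiff ℝ n f)
    (hmn : m + 1 ≤ n) : ContDiff ℝ m (gradient f) :=
  (InnerProductSpace.toDual ℝ E).symm.contDiff.comp (hf.fderiv_right hmn)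

/-- The Hessian of a `C²` function is symmetric. -/
theorem ContDiff.inner_fderiv_gradient_comm {f : E → ℝ} (hf : ContDiff ℝ 2 f) (x v w : E) :
    ⟪fderiv ℝ (gradient f) x v, w⟫ = ⟪v, fderiv ℝ (gradient f) x w⟫ := by
  have key (a b : E) : ⟪fderiv ℝ (gradient f) x a, b⟫ = fderiv ℝ (fderiv ℝ f) x a b := by
    have hd : DifferentiableAt ℝ (gradient f) x :=
      (hf.contDiff_gradient (m := 1) (by norm_num)).differentiable one_ne_zero x
    have hcomp : HasFDerivAt (InnerProductSpace.toDual ℝ E ∘ gradient f) _ x :=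
      (InnerProductSpace.toDual ℝ E).toContinuousLinearEquiv.hasFDerivAt.comp x hd.hasFDerivAt
    rw [← toDual_comp_gradient, hcomp.fderiv]
    rfl
  have hs : IsSymmSndFDerivAt ℝ f x := hf.contDiffAt.isSymmSndFDerivAt (by simp)
  rw [key, real_inner_comm, key, hs.eq]

end GradientHessian

/-- If `G` is strictly differentiable at a zero `a` with invertible derivative `H`, and
`θ ε → a` solves `G (θ ε) = ε • w ε` with `w ε → g`, then `θ` has first-order expansion
`H⁻¹ g` at `ε = 0`. -/
theorem HasStrictFDerivAt.tendsto_inv_smul_sub_of_eq_smul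
    {E F : Type*} [NormedAddCommGroup E] [NormedSpace ℝ E] [CompleteSpace E]
    [NormedAddCommGroup F] [NormedSpace ℝ F]
    {G : E → F} {H : E ≃L[ℝ] F} {a : E} (hG : HasStrictFDerivAt G (H : E →L[ℝ] F) a)
    (ha : G a = 0) {θ : ℝ → E} {w : ℝ → F} {g : F}
    (hθ : Tendsto θ (𝓝[>] 0) (𝓝 a)) (hw : Tendsto w (𝓝[>] 0) (𝓝 g))
    (heq : ∀ᶠ ε in 𝓝[>] 0, G (θ ε) = ε • w ε) :
    Tendsto (fun ε => ε⁻¹ • (θ ε - a)) (𝓝[>] 0) (𝓝 (H.symm g)) := by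
  have hid : Tendsto (fun ε : ℝ => ε) (𝓝[>] 0) (𝓝 0) := nhdsWithin_le_nhds
  have hinv := hG.to_localInverse.hasFDerivAt.hasFDerivWithinAt (s := Set.univ)
  have hlim := hinv.lim (l := 𝓝[>] (0 : ℝ)) (c := fun ε => ε⁻¹) (d := fun ε => ε • w ε)
    (v := g) (by simpa using hid.smul hw) (by simp) (hw.congr' (by
      filter_upwards [self_mem_nhdsWithin] with ε hε
      rw [inv_smul_smul₀ (ne_of_gt hε)]))
  refine hlim.congr' ?_
  filter_upwards [heq, hθ.eventually hG.eventually_left_inverse] with ε h1 h2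
  rw [hG.localInverse_apply_image, ha, zero_add, ← h1, h2]

/-- The variance under the uniform distribution on `Fin N` is invariant under shifts. -/
theorem uniform_variance_sub_const {N : ℕ} (x : Fin N → ℝ) (c : ℝ) :
    (N : ℝ)⁻¹ * ∑ i, (x i - c) ^ 2 - ((N : ℝ)⁻¹ * ∑ i, (x i - c)) ^ 2 =
      (N : ℝ)⁻¹ * ∑ i, x i ^ 2 - ((N : ℝ)⁻¹ * ∑ i, x i) ^ 2 := by
  rcases Nat.eq_zero_or_pos N with rfl | hN
  · simp
  have hN' : (N : ℝ) ≠ 0 := by positivity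
  simp only [sub_sq, Finset.sum_add_distrib, Finset.sum_sub_distrib, ← Finset.sum_mul,
    ← Finset.mul_sum, Finset.sum_const, Finset.card_univ, Fintype.card_fin, nsmul_eq_mul]
  field_simp
  ring

/-- **Infinitesimal leave-one-out variance equals the sandwich Delta Variance
(Proposition 2).** With `ℓ₁, …, ℓ_N` the per-data-point log-likelihoods (each `C²` with
locally Lipschitz Hessian near `θ̄`), `u` `C¹` with locally Lipschitz gradient near `θ̄`,
`Σⱼ ∇ℓⱼ(θ̄) = 0`, `H = Σⱼ Hess ℓⱼ(θ̄)` invertible, `gᵢ = ∇ℓᵢ(θ̄)`,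
`F̂ = (1/N)·Σᵢ gᵢ gᵢ⊤`, and `θᵢ(ε)` critical points of the `ε`-down-weighted objective
converging to `θ̄`, we have
`lim_{ε→0⁺} ((N − ε)/ε²)·Var_{i∼U(1,…,N)}[u(θᵢ(ε))] = N·⟨∇u(θ̄), H⁻¹ F̂ H⁻¹ ∇u(θ̄)⟩`,
where `Var_{i∼U}[Xᵢ] = (1/N)·Σᵢ Xᵢ² − ((1/N)·Σᵢ Xᵢ)²`. -/
theorem infinitesimal_jackknife_delta_variance
    {d N : ℕ} (ℓ : Fin N → EuclideanSpace ℝ (Fin d) → ℝ)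
    (θb : EuclideanSpace ℝ (Fin d))
    (hℓ : ∀ j, ContDiff ℝ 2 (ℓ j))
    (hℓHessLip : ∀ j, ∃ K : ℝ≥0, ∃ s ∈ 𝓝 θb,
      LipschitzOnWith K (fun θ => fderiv ℝ (gradient (ℓ j)) θ) s)
    (u : EuclideanSpace ℝ (Fin d) → ℝ)
    (hu : ContDiff ℝ 1 u)
    (huGradLip : ∃ K : ℝ≥0, ∃ s ∈ 𝓝 θb, LipschitzOnWith K (gradient u) s)
    (hcrit : (∑ j, gradient (ℓ j) θb) = 0)
    (H : EuclideanSpace ℝ (Fin d) ≃L[ℝ] EuclideanSpace ℝ (Fin d))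
    (hH : (H : EuclideanSpace ℝ (Fin d) →L[ℝ] EuclideanSpace ℝ (Fin d)) =
      ∑ j, fderiv ℝ (gradient (ℓ j)) θb)
    (ε₀ : ℝ) (hε₀ : 0 < ε₀)
    (θi : Fin N → ℝ → EuclideanSpace ℝ (Fin d))
    (hθi : ∀ i, ∀ ε ∈ Set.Ioo 0 ε₀,
      (∑ j, gradient (ℓ j) (θi i ε)) - ε • gradient (ℓ i) (θi i ε) = 0)
    (hconv : ∀ i, Tendsto (θi i) (𝓝[>] 0) (𝓝 θb)) :
    Tendsto
      (fun ε : ℝ => (((N : ℝ) - ε) / ε ^ 2) *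
        ((N : ℝ)⁻¹ * ∑ i, (u (θi i ε)) ^ 2 - ((N : ℝ)⁻¹ * ∑ i, u (θi i ε)) ^ 2))
      (𝓝[>] 0)
      (𝓝 ((N : ℝ) * ⟪gradient u θb,
        H.symm ((N : ℝ)⁻¹ • ∑ i, ⟪gradient (ℓ i) θb, H.symm (gradient u θb)⟫ •
          gradient (ℓ i) θb)⟫)) := by
  let G : EuclideanSpace ℝ (Fin d) → EuclideanSpace ℝ (Fin d) :=
    fun θ => ∑ j, gradient (ℓ j) θ
  have hgrad (j) : ContDiff ℝ 1 (gradient (ℓ j)) := (hℓ j).contDiff_gradient (by norm_num)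
  have hG : HasStrictFDerivAt G
      (H : EuclideanSpace ℝ (Fin d) →L[ℝ] EuclideanSpace ℝ (Fin d)) θb := by
    rw [hH]
    exact HasStrictFDerivAt.fun_sum fun j _ =>
      (hgrad j).contDiffAt.hasStrictFDerivAt one_ne_zero
  have hsymm (v w) : ⟪H.symm v, w⟫ = ⟪v, H.symm w⟫ := by
    have hHs (a b) : ⟪H a, b⟫ = ⟪a, H b⟫ := by
      simp only [← ContinuousLinearEquiv.coe_coe, hH, sum_apply,
        sum_inner, inner_sum, (hℓ _).inner_fderiv_gradient_comm]
    simpa using (hHs (H.symm v) (H.symm w)).symm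
  set D : Fin N → ℝ := fun i => ⟪gradient u θb, H.symm (gradient (ℓ i) θb)⟫ with hD
  have hsumD : ∑ i, D i = 0 := by
    simp only [hD, ← inner_sum, ← map_sum, hcrit, map_zero, inner_zero_right]
  have hlim (i) : Tendsto (fun ε => ε⁻¹ * (u (θi i ε) - u θb)) (𝓝[>] 0) (𝓝 (D i)) := by
    have hθ := hG.tendsto_inv_smul_sub_of_eq_smul hcrit (hconv i)
      (((hgrad i).continuous.tendsto θb).comp (hconv i)) (by
        filter_upwards [Ioo_mem_nhdsGT hε₀] with ε hε
        exact sub_eq_zero.mp (hθi i ε hε))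
    have hu' := (hu.differentiable one_ne_zero θb).hasGradientAt.hasFDerivAt
    have := hu'.hasFDerivWithinAt (s := Set.univ) |>.lim
      (d := fun ε => θi i ε - θb) (by simpa using (hconv i).sub_const θb) (by simp) hθ
    simpa [hD, inner_gradient_left] using this
  have hvar : Tendsto (fun ε : ℝ => ((N : ℝ) - ε) *
      ((N : ℝ)⁻¹ * ∑ i, (ε⁻¹ * (u (θi i ε) - u θb)) ^ 2 -
        ((N : ℝ)⁻¹ * ∑ i, ε⁻¹ * (u (θi i ε) - u θb)) ^ 2)) (𝓝[>] 0)
      (𝓝 (((N : ℝ) - 0) * ((N : ℝ)⁻¹ * ∑ i, D i ^ 2 - ((N : ℝ)⁻¹ * ∑ i, D i) ^ 2))) := by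
    have hid : Tendsto (fun ε : ℝ => ε) (𝓝[>] 0) (𝓝 0) := nhdsWithin_le_nhds
    exact (hid.const_sub _).mul
      (((tendsto_finsetSum _ fun i _ => (hlim i).pow 2).const_mul _).sub
        (((tendsto_finsetSum _ fun i _ => hlim i).const_mul _).pow 2))
  convert hvar using 2 with ε
  · rw [← uniform_variance_sub_const (fun i => u (θi i ε)) (u θb)]
    simp only [mul_pow, ← Finset.mul_sum]
    ring
  · have hterm (i) : ⟪gradient (ℓ i) θb, H.symm (gradient u θb)⟫ = D i := by
      rw [← hsymm, real_inner_comm]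
    simp only [hterm, hsumD, map_smul, map_sum, inner_smul_right, inner_sum]
    simp [hD, sq]
end

section
/- Let u : ℝ^d → ℝ be twice continuously differentiable with ‖Hess u‖ bounded on a neighborhood of θ̄, let v ∈ ℝ^d and set ν := ⟨∇u(θ̄), v⟩. Let (Ω, 𝔽, P) be a probability space and δ : Ω → ℝ a bounded random variable with E[δ] = 0 and E[δ²] = σ². Suppose ε₀ > 0, K ≥ 0 and θ : (0, ε₀) × Ω → ℝ^d satisfy the uniform expansion ‖θ(ε, ω) − θ̄ − ε·δ(ω)·v‖ ≤ K·ε² for all ω ∈ Ω and ε ∈ (0, ε₀). Then there exist constants K′ ≥ 0 and ε₁ > 0 such that for all 0 < ε < ε₁, |E_ω[(u(θ̄) − u(θ(ε, ω)))²] − ε²·σ²·ν²| ≤ K′·ε³. -/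
open MeasureTheory
open scoped RealInnerProductSpace Topology

/-- First-order Taylor estimate with quadratic remainder at a point where `f` is `C²`. -/
theorem ContDiffAt.exists_norm_sub_sub_fderiv_le_sq {E F : Type*} [NormedAddCommGroup E]
    [NormedSpace ℝ E] [NormedAddCommGroup F] [NormedSpace ℝ F] {f : E → F} {x : E}
    (hf : ContDiffAt ℝ 2 f x) :
    ∃ C ≥ (0 : ℝ), ∃ r > (0 : ℝ), ∀ y ∈ Metric.ball x r,
      ‖f y - f x - fderiv ℝ f x (y - x)‖ ≤ C * ‖y - x‖ ^ 2 := by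
  have hf' : ContDiffAt ℝ 1 (fderiv ℝ f) x := hf.fderiv_right (by norm_num)
  obtain ⟨C, t, ht, hlip⟩ := hf'.exists_lipschitzOnWith
  have hdiff : ∀ᶠ y in 𝓝 x, DifferentiableAt ℝ f y :=
    (hf.eventually (by simp)).mono fun y hy => hy.differentiableAt (by norm_num)
  obtain ⟨r, hr, hball⟩ := Metric.mem_nhds_iff.1 (Filter.inter_mem ht hdiff)
  refine ⟨C, C.2, r, hr, fun y hy => ?_⟩
  have hsub : Metric.closedBall x ‖y - x‖ ⊆ t ∩ {y | DifferentiableAt ℝ f y} :=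
    (Metric.closedBall_subset_ball (by rwa [← dist_eq_norm])).trans hball
  have key := (convex_closedBall x ‖y - x‖).norm_image_sub_le_of_norm_fderiv_le'
    (𝕜 := ℝ) (f := f) (φ := fderiv ℝ f x) (C := C * ‖y - x‖) (x := x) (y := y)
    (fun z hz => (hsub hz).2)
    (fun z hz => (hlip.norm_sub_le (hsub hz).1 (mem_of_mem_nhds ht)).trans
      (mul_le_mul_of_nonneg_left (mem_closedBall_iff_norm.1 hz) C.2))
    (Metric.mem_closedBall_self (norm_nonneg _)) (mem_closedBall_iff_norm.2 le_rfl)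
  exact key.trans_eq (by ring)

/-- **Noise-adversarial data injection (Proposition 4).** If `u` is `C²` with Hessian bounded
on a neighborhood of `θ̄`, `ν = ⟨∇u(θ̄), v⟩`, `δ` is a bounded zero-mean random variable with
`E[δ²] = σ²`, and the retrained parameters satisfy the uniform expansion
`‖θ(ε, ω) − θ̄ − ε·δ(ω)·v‖ ≤ K·ε²`, then
`E_ω[(u(θ̄) − u(θ(ε, ω)))²] = ε²·σ²·ν² + O(ε³)`. -/
theorem noise_adversarial_expected_change
    {d : ℕ} (u : EuclideanSpace ℝ (Fin d) → ℝ) (θb : EuclideanSpace ℝ (Fin d))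
    (hu : ContDiff ℝ 2 u)
    (hM : ∃ M : ℝ, ∃ s ∈ 𝓝 θb, ∀ θ ∈ s, ‖fderiv ℝ (gradient u) θ‖ ≤ M)
    (v : EuclideanSpace ℝ (Fin d)) (ν : ℝ) (hν : ν = ⟪gradient u θb, v⟫)
    {Ω : Type*} [MeasurableSpace Ω] (P : Measure Ω) [IsProbabilityMeasure P]
    (δ : Ω → ℝ) (hδmeas : Measurable δ)
    (Cb : ℝ) (hδbdd : ∀ ω, |δ ω| ≤ Cb)
    (σ : ℝ) (hmean : ∫ ω, δ ω ∂P = 0) (hvar : ∫ ω, (δ ω) ^ 2 ∂P = σ ^ 2)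
    (ε₀ K : ℝ) (hε₀ : 0 < ε₀) (hK : 0 ≤ K)
    (θ : ℝ → Ω → EuclideanSpace ℝ (Fin d))
    (hθmeas : ∀ ε, Measurable (θ ε))
    (hθ : ∀ ω, ∀ ε ∈ Set.Ioo 0 ε₀, ‖θ ε ω - θb - (ε * δ ω) • v‖ ≤ K * ε ^ 2) :
    ∃ K' ≥ (0 : ℝ), ∃ ε₁ > (0 : ℝ), ∀ ε : ℝ, 0 < ε → ε < ε₁ →
      |(∫ ω, (u θb - u (θ ε ω)) ^ 2 ∂P) - ε ^ 2 * σ ^ 2 * ν ^ 2| ≤ K' * ε ^ 3 := by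
  have hfν : fderiv ℝ u θb v = ν := by
    rw [hν, gradient, InnerProductSpace.toDual_symm_apply]
  obtain ⟨C, hC, r, hr, hTaylor⟩ :=
    (hu.contDiffAt (x := θb)).exists_norm_sub_sub_fderiv_le_sq
  have hCb : 0 ≤ Cb := by
    obtain ⟨ω⟩ := nonempty_of_isProbabilityMeasure P
    exact (abs_nonneg _).trans (hδbdd ω)
  set L := ‖fderiv ℝ u θb‖
  set A := Cb * ‖v‖ + K with hA
  have hA0 : 0 ≤ A := by positivity
  set D := L * K + C * A ^ 2 with hD
  have hD0 : 0 ≤ D := by positivity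
  refine ⟨D * (2 * Cb * |ν| + D), by positivity, min (min ε₀ 1) (r / (A + 1)),
    by positivity, fun ε hε hε' => ?_⟩
  obtain ⟨⟨hεε₀, hε1⟩, hεr⟩ : (ε < ε₀ ∧ ε < 1) ∧ ε < r / (A + 1) := by
    simpa only [lt_min_iff] using hε'
  have hrem : ∀ ω, |u (θ ε ω) - u θb - ε * δ ω * ν| ≤ D * ε ^ 2 := by
    intro ω
    have hexp := hθ ω ε ⟨hε, hεε₀⟩
    have hlin : ‖(ε * δ ω) • v‖ ≤ ε * (Cb * ‖v‖) := by
      rw [norm_smul, norm_mul, Real.norm_of_nonneg hε.le, mul_assoc, Real.norm_eq_abs]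
      gcongr
      exact hδbdd ω
    have hdist : ‖θ ε ω - θb‖ ≤ A * ε := by
      have := norm_le_norm_sub_add (θ ε ω - θb) ((ε * δ ω) • v)
      have : K * ε ^ 2 ≤ K * ε := by gcongr; nlinarith
      rw [hA]
      linarith
    have hmem : θ ε ω ∈ Metric.ball θb r := by
      rw [mem_ball_iff_norm]
      have := (lt_div_iff₀ (by positivity)).1 hεr
      linarith
    have hT := hTaylor _ hmem
    have hq : C * ‖θ ε ω - θb‖ ^ 2 ≤ C * (A * ε) ^ 2 := by gcongr
    have hl : ‖fderiv ℝ u θb (θ ε ω - θb - (ε * δ ω) • v)‖ ≤ L * (K * ε ^ 2) :=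
      (fderiv ℝ u θb).le_of_opNorm_le_of_le le_rfl hexp
    have hsplit : u (θ ε ω) - u θb - ε * δ ω * ν =
        (u (θ ε ω) - u θb - fderiv ℝ u θb (θ ε ω - θb)) +
          fderiv ℝ u θb (θ ε ω - θb - (ε * δ ω) • v) := by
      rw [map_sub _ (θ ε ω - θb), map_smul, hfν, smul_eq_mul]
      ring
    rw [hsplit, hD, ← Real.norm_eq_abs]
    refine (norm_add_le _ _).trans ?_
    linarith
  have hbound : ∀ ω, ‖(u θb - u (θ ε ω)) ^ 2 - ε ^ 2 * ν ^ 2 * δ ω ^ 2‖ ≤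
      D * (2 * Cb * |ν| + D) * ε ^ 3 := by
    intro ω
    set R := u (θ ε ω) - u θb - ε * δ ω * ν with hR
    have hfac : (u θb - u (θ ε ω)) ^ 2 - ε ^ 2 * ν ^ 2 * δ ω ^ 2 =
        R * (2 * (ε * δ ω * ν) + R) := by
      rw [hR]
      ring
    have hmain : |2 * (ε * δ ω * ν)| ≤ 2 * (ε * Cb * |ν|) := by
      rw [abs_mul, abs_mul, abs_mul, abs_two, abs_of_pos hε]
      gcongr
      exact hδbdd ω
    have hRε : |R| ≤ D * ε := (hrem ω).trans (by gcongr; nlinarith)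
    rw [hfac, Real.norm_eq_abs, abs_mul]
    calc |R| * |2 * (ε * δ ω * ν) + R|
        ≤ D * ε ^ 2 * (2 * (ε * Cb * |ν|) + D * ε) := by
          gcongr
          · exact hrem ω
          · exact (abs_add_le _ _).trans (add_le_add hmain hRε)
      _ = D * (2 * Cb * |ν| + D) * ε ^ 3 := by ring
  have hmeas : Measurable fun ω => (u θb - u (θ ε ω)) ^ 2 :=
    (measurable_const.sub (hu.continuous.measurable.comp (hθmeas ε))).pow_const 2
  have hδint : Integrable (fun ω => ε ^ 2 * ν ^ 2 * δ ω ^ 2) P := by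
    refine (Integrable.of_bound (hδmeas.pow_const 2).aestronglyMeasurable (Cb ^ 2)
      (.of_forall fun ω => ?_)).const_mul _
    rw [norm_pow, Real.norm_eq_abs]
    gcongr
    exact hδbdd ω
  have hdint : Integrable
      (fun ω => (u θb - u (θ ε ω)) ^ 2 - ε ^ 2 * ν ^ 2 * δ ω ^ 2) P :=
    Integrable.of_bound (hmeas.aestronglyMeasurable.sub hδint.aestronglyMeasurable) _
      (.of_forall hbound)
  have hint : Integrable (fun ω => (u θb - u (θ ε ω)) ^ 2) P := by
    exact (hdint.add hδint).congr (.of_forall fun ω => sub_add_cancel _ _)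
  have hconst : ε ^ 2 * σ ^ 2 * ν ^ 2 = ∫ ω, ε ^ 2 * ν ^ 2 * δ ω ^ 2 ∂P := by
    rw [integral_const_mul, hvar]
    ring
  rw [hconst, ← integral_sub hint hδint]
  simpa using norm_integral_le_of_norm_le_const (μ := P) (.of_forall hbound)
end
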